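/- Let A be the attractor of a holomorphic IFS (G, Ω) satisfying the strong separation condition. Then A is a J-like Cantor set (that is, A is compact, totally disconnected, has no isolated points, and is J-like). -/

import Mathlib

open Set Metric

noncomputable section

/-- A finite holomorphic IFS: a bounded domain `Ω ⊂ ℂ` together with finitely many
univalent maps `g i : Ω → Ω` with `closure (g i '' Ω) ⊆ Ω`. -/
structure HolIFS where
  /-- the number of maps -/
  m : ℕ
  hm : 1 ≤ m
  /-- the domain -/
  Ω : Set ℂ
  hopen : IsOpen Ω
  hconn : IsConnected Ω
  hbdd : Bornology.IsBounded Ω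
  /-- the maps of the IFS -/
  g : Fin m → ℂ → ℂ
  hdiff : ∀ i, DifferentiableOn ℂ (g i) Ω
  hinj : ∀ i, Set.InjOn (g i) Ω
  hcl : ∀ i, closure (g i '' Ω) ⊆ Ω

/-- `A` is the attractor of the IFS `S`: the (unique) nonempty compact subset of `Ω`
with `A = ⋃ i, g i '' A`. -/
def HolIFS.IsAttractor (S : HolIFS) (A : Set ℂ) : Prop :=
  A.Nonempty ∧ IsCompact A ∧ A ⊆ S.Ω ∧ A = ⋃ i, S.g i '' A

/-- The strong separation condition for the IFS `S` with attractor `A`. -/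
def HolIFS.SSC (S : HolIFS) (A : Set ℂ) : Prop :=
  ∀ i j : Fin S.m, i ≠ j → Disjoint (S.g i '' A) (S.g j '' A)

/-- For a finite word `w = [i₁, …, i_k]`, the composition `g_w = g i₁ ∘ ⋯ ∘ g i_k`. -/
def HolIFS.word (S : HolIFS) (w : List (Fin S.m)) : ℂ → ℂ :=
  w.foldr (fun i f => S.g i ∘ f) id

/-- `H` is a local holomorphic symmetry of the compact set `K` on the domain `D`. -/
def IsSymmetryOn (K D : Set ℂ) (H : ℂ → ℂ) : Prop :=
  DifferentiableOn ℂ H D ∧ ∀ x ∈ D, (x ∈ K ↔ H x ∈ K)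

/-- The set of attracting fixed points of local holomorphic symmetries of `K`. -/
def AttrFixedPts (K : Set ℂ) : Set ℂ :=
  {b | ∃ (D : Set ℂ) (H : ℂ → ℂ), IsOpen D ∧ IsConnected D ∧ (D ∩ K).Nonempty ∧
    IsSymmetryOn K D H ∧ b ∈ D ∧ H b = b ∧
    0 < ‖deriv H b‖ ∧ ‖deriv H b‖ < 1}

/-- `K` is J-like relative to `U`. -/
def JLikeRel (K U : Set ℂ) : Prop :=
  U ∩ K ⊆ closure (AttrFixedPts K)

/-- `K` is J-like: it is J-like relative to some open neighborhood of `K`. -/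
def JLike (K : Set ℂ) : Prop :=
  ∃ U : Set ℂ, IsOpen U ∧ K ⊆ U ∧ JLikeRel K U

open Filter Topology

/-- An analytic function which is injective near a point has nonzero derivative there. -/
theorem deriv_ne_zero_of_injOn_nhds {f : ℂ → ℂ} {b : ℂ} {V : Set ℂ} (hf : AnalyticAt ℂ f b)
    (hV : V ∈ 𝓝 b) (hinj : InjOn f V) : deriv f b ≠ 0 := by
  intro hd
  have hfs : AnalyticAt ℂ (fun z => f z - f b) b := hf.sub analyticAt_const
  have hfin : analyticOrderAt (fun z => f z - f b) b ≠ ⊤ := by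
    intro htop
    rw [analyticOrderAt_eq_top] at htop
    have h1 : ∀ᶠ z in 𝓝[≠] b, z = b := by
      filter_upwards [nhdsWithin_le_nhds htop, nhdsWithin_le_nhds hV] with z hz hzV
      exact hinj hzV (mem_of_mem_nhds hV) (sub_eq_zero.1 hz)
    obtain ⟨z, hz, hz'⟩ := (h1.and self_mem_nhdsWithin).exists
    exact hz' hz
  obtain ⟨u, hu, hub, hfu⟩ := (hfs.analyticOrderAt_ne_top).1 hfin
  set k := analyticOrderNatAt (fun z => f z - f b) b
  have hk0 : k ≠ 0 := by
    intro h0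
    have := hfu.self_of_nhds
    simp [h0] at this
    exact hub this.symm
  have hk1 : k ≠ 1 := by
    intro h1
    have hder : HasDerivAt (fun z => (z - b) * u z) (1 * u b + (b - b) * deriv u b) b :=
      ((hasDerivAt_id b).sub_const b).mul hu.differentiableAt.hasDerivAt
    have hder' : HasDerivAt (fun z => f z - f b) (deriv f b) b :=
      hf.differentiableAt.hasDerivAt.sub_const _
    have heq : (fun z => f z - f b) =ᶠ[𝓝 b] fun z => (z - b) * u z := by
      filter_upwards [hfu] with z hz
      simpa [h1] using hz
    have := (hder'.congr_of_eventuallyEq heq.symm).unique hder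
    rw [hd] at this
    simp at this
    exact hub this.symm
  obtain ⟨c, hc⟩ := IsAlgClosed.exists_pow_nat_eq (u b) (Nat.pos_of_ne_zero hk0)
  have hc0 : c ≠ 0 := by
    rintro rfl
    rw [zero_pow hk0] at hc
    exact hub hc.symm
  have hslit : u b / u b ∈ Complex.slitPlane := by
    rw [div_self hub]; exact Complex.one_mem_slitPlane
  have hq : AnalyticAt ℂ (fun z => u z / u b) b := hu.div analyticAt_const hub
  have hh : AnalyticAt ℂ (fun z => c * Complex.exp (Complex.log (u z / u b) / k)) b :=
    analyticAt_const.mul ((hq.clog hslit).div analyticAt_const (by exact_mod_cast hk0)).cexp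
  set h : ℂ → ℂ := fun z => c * Complex.exp (Complex.log (u z / u b) / k) with hhdef
  have hhb : h b = c := by simp [hhdef, div_self hub]
  have hφ : AnalyticAt ℂ (fun z => (z - b) * h z) b :=
    (analyticAt_id.sub analyticAt_const).mul hh
  have hφd : HasDerivAt (fun z => (z - b) * h z) c b := by
    have : HasDerivAt (fun z => (z - b) * h z) (1 * h b + (b - b) * deriv h b) b :=
      ((hasDerivAt_id b).sub_const b).mul hh.differentiableAt.hasDerivAt
    simpa [hhb] using this
  have hmap : map (fun z => (z - b) * h z) (𝓝 b) = 𝓝 0 := by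
    have := hφ.hasStrictDerivAt.map_nhds_eq (by rw [hφd.deriv]; exact hc0)
    simpa using this
  have hpow : ∀ᶠ z in 𝓝 b, f z - f b = ((z - b) * h z) ^ k := by
    filter_upwards [hfu, hu.continuousAt.eventually_ne hub] with z hz huz
    rw [hz, mul_pow, smul_eq_mul]
    congr 1
    rw [hhdef]
    simp only
    rw [mul_pow, hc, ← Complex.exp_nat_mul, mul_div_cancel₀ _ (by exact_mod_cast hk0),
      Complex.exp_log (div_ne_zero huz hub), mul_div_cancel₀ _ hub]
  have himg : (fun z => (z - b) * h z) '' (V ∩ {z | f z - f b = ((z - b) * h z) ^ k}) ∈ 𝓝 (0:ℂ) := by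
    rw [← hmap]
    exact image_mem_map (inter_mem hV hpow)
  obtain ⟨ε, hε, hball⟩ := Metric.mem_nhds_iff.1 himg
  have hζ := Complex.isPrimitiveRoot_exp k hk0
  set ζ := Complex.exp (2 * Real.pi * Complex.I / k)
  have hζ1 : ζ ≠ 1 := hζ.ne_one (by omega)
  have hζn : ‖ζ‖ = 1 := hζ.norm'_eq_one hk0
  have hw : ((ε / 2 : ℝ) : ℂ) ∈ ball (0:ℂ) ε := by
    rw [mem_ball_zero_iff, Complex.norm_real, Real.norm_of_nonneg (by positivity)]; linarith
  have hw' : ζ * ((ε / 2 : ℝ) : ℂ) ∈ ball (0:ℂ) ε := by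
    rw [mem_ball_zero_iff, norm_mul, hζn, one_mul, ← mem_ball_zero_iff]; exact hw
  obtain ⟨z₁, ⟨h1V, h1⟩, e1⟩ := hball hw
  obtain ⟨z₂, ⟨h2V, h2⟩, e2⟩ := hball hw'
  simp only [mem_ofPred_eq] at h1 h2 e1 e2
  have hz : z₁ = z₂ := by
    apply hinj h1V h2V
    rw [e1] at h1
    rw [e2, mul_pow, hζ.pow_eq_one, one_mul, ← h1] at h2
    exact (sub_left_inj.1 h2).symm
  subst hz
  rw [e1] at e2
  have hne : ((ε / 2 : ℝ) : ℂ) ≠ 0 := by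
    rw [Complex.ofReal_ne_zero]; positivity
  exact hζ1 (mul_right_cancel₀ hne (by rw [one_mul]; exact e2.symm))

namespace HolIFS

variable (S : HolIFS)

theorem word_nil (x : ℂ) : S.word [] x = x := rfl

theorem word_cons (i : Fin S.m) (w : List (Fin S.m)) (x : ℂ) :
    S.word (i :: w) x = S.g i (S.word w x) := rfl

theorem word_append (u v : List (Fin S.m)) (x : ℂ) :
    S.word (u ++ v) x = S.word u (S.word v x) := by
  induction u with
  | nil => rfl
  | cons i u ih => rw [List.cons_append, word_cons, word_cons, ih]

theorem mapsTo_g (i : Fin S.m) : MapsTo (S.g i) S.Ω S.Ω := fun _ hx =>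
  S.hcl i (subset_closure (mem_image_of_mem _ hx))

theorem mapsTo_word (w : List (Fin S.m)) : MapsTo (S.word w) S.Ω S.Ω := by
  induction w with
  | nil => exact mapsTo_id _
  | cons i w ih => exact (S.mapsTo_g i).comp ih

theorem differentiableOn_word (w : List (Fin S.m)) : DifferentiableOn ℂ (S.word w) S.Ω := by
  induction w with
  | nil => exact differentiableOn_id
  | cons i w ih => exact (S.hdiff i).comp ih (S.mapsTo_word w)

theorem injOn_word (w : List (Fin S.m)) : InjOn (S.word w) S.Ω := by
  induction w with
  | nil => exact injOn_id _
  | cons i w ih => exact (S.hinj i).comp ih (S.mapsTo_word w)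

theorem differentiableAt_word (w : List (Fin S.m)) {x : ℂ} (hx : x ∈ S.Ω) :
    DifferentiableAt ℂ (S.word w) x :=
  (S.differentiableOn_word w).differentiableAt (S.hopen.mem_nhds hx)

theorem deriv_word_ne_zero (w : List (Fin S.m)) {x : ℂ} (hx : x ∈ S.Ω) :
    deriv (S.word w) x ≠ 0 :=
  deriv_ne_zero_of_injOn_nhds ((S.differentiableOn_word w).analyticAt (S.hopen.mem_nhds hx))
    (S.hopen.mem_nhds hx) (S.injOn_word w)

/-- Each map of the IFS can be followed by a uniform dilation about any of its values without
leaving `Ω`. -/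
theorem exists_dilation : ∃ ε > 0, ∀ i, ∀ z ∈ S.Ω, ∀ ζ ∈ S.Ω,
    S.g i ζ + (ε : ℝ) * (S.g i ζ - S.g i z) ∈ S.Ω := by
  have hK : IsCompact (⋃ i, closure (S.g i '' S.Ω)) := isCompact_iUnion fun i =>
    (S.hbdd.subset (image_subset_iff.2 (S.mapsTo_g i))).isCompact_closure
  obtain ⟨δ, hδ, hsub⟩ := hK.exists_thickening_subset_open S.hopen (iUnion_subset S.hcl)
  obtain ⟨M, hM⟩ := isBounded_iff.1 S.hbdd
  have hM0 : 0 ≤ M := by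
    obtain ⟨x, hx⟩ := S.hconn.nonempty
    simpa using hM hx hx
  refine ⟨δ / (M + 1), by positivity, fun i z hz ζ hζ => hsub ?_⟩
  rw [mem_thickening_iff]
  refine ⟨S.g i ζ, mem_iUnion.2 ⟨i, subset_closure (mem_image_of_mem _ hζ)⟩, ?_⟩
  have h1 := hM (S.mapsTo_g i hζ) (S.mapsTo_g i hz)
  rw [dist_eq_norm] at h1
  rw [dist_eq_norm, add_sub_cancel_left, norm_mul, Complex.norm_real,
    Real.norm_of_nonneg (by positivity)]
  calc δ / (M + 1) * ‖S.g i ζ - S.g i z‖ ≤ δ / (M + 1) * M := by gcongr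
    _ < δ / (M + 1) * (M + 1) := by gcongr; linarith
    _ = δ := by field_simp

/-- The derivatives of word maps decay exponentially in the length of the word. -/
theorem exists_norm_deriv_word_le : ∃ k M : ℝ, 0 < k ∧ k < 1 ∧ 0 ≤ M ∧ ∀ w : List (Fin S.m),
    ∀ z r, 0 < r → ball z r ⊆ S.Ω → ‖deriv (S.word w) z‖ ≤ k ^ w.length * (M / r) := by
  obtain ⟨ε, hε, hdil⟩ := S.exists_dilation
  obtain ⟨M, hM⟩ := isBounded_iff.1 S.hbdd
  have hM0 : 0 ≤ M := by
    obtain ⟨x, hx⟩ := S.hconn.nonempty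
    simpa using hM hx hx
  have key : ∀ w : List (Fin S.m), ∀ z ∈ S.Ω, ∃ h : ℂ → ℂ, DifferentiableOn ℂ h S.Ω ∧
      MapsTo h S.Ω S.Ω ∧ h z = S.word w z ∧
      deriv h z = (1 + ε : ℝ) ^ w.length * deriv (S.word w) z := by
    intro w z hz
    induction w with
    | nil => exact ⟨id, differentiableOn_id, mapsTo_id _, rfl, by simp [word]⟩
    | cons i w ih =>
      obtain ⟨h, hd, hm, hhz, hder⟩ := ih
      have hgd := (S.hdiff i).comp hd hm
      refine ⟨fun ζ => S.g i (h ζ) + (ε : ℝ) * (S.g i (h ζ) - S.g i (S.word w z)), ?_, ?_, ?_, ?_⟩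
      · exact hgd.add ((hgd.sub_const _).const_mul _)
      · exact fun ζ hζ => hdil i _ (S.mapsTo_word w hz) _ (hm hζ)
      · simp [hhz, word_cons]
      · have hg : HasDerivAt (S.g i) (deriv (S.g i) (S.word w z)) (S.word w z) :=
          ((S.hdiff i).differentiableAt (S.hopen.mem_nhds (S.mapsTo_word w hz))).hasDerivAt
        have hh : HasDerivAt h (deriv h z) z :=
          (hd.differentiableAt (S.hopen.mem_nhds hz)).hasDerivAt
        have h1 : HasDerivAt (fun ζ => S.g i (h ζ)) (deriv (S.g i) (S.word w z) * deriv h z) z :=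
          HasDerivAt.comp z (by rw [hhz]; exact hg) hh
        have h2 : HasDerivAt (S.word (i :: w))
            (deriv (S.g i) (S.word w z) * deriv (S.word w) z) z :=
          HasDerivAt.comp (h := S.word w) z hg (S.differentiableAt_word w hz).hasDerivAt
        have h3 := h1.add ((h1.sub_const (S.g i (S.word w z))).const_mul ((ε : ℝ) : ℂ))
        rw [h2.deriv]
        refine h3.deriv.trans ?_
        rw [hder, List.length_cons, pow_succ]
        push_cast
        ring
  refine ⟨(1 + ε)⁻¹, M, by positivity, inv_lt_one_of_one_lt₀ (by linarith), hM0, ?_⟩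
  intro w z r hr hball
  have hz : z ∈ S.Ω := hball (mem_ball_self hr)
  obtain ⟨h, hd, hm, hhz, hder⟩ := key w z hz
  have hle : ‖deriv h z‖ ≤ M / r :=
    Complex.norm_deriv_le_div_of_mapsTo_ball (hd.mono hball)
      (fun ζ hζ => mem_closedBall.2 (hM (hm (hball hζ)) (hm hz))) hr
  rw [hder, norm_mul, norm_pow, Complex.norm_real, Real.norm_of_nonneg (by positivity)] at hle
  rw [inv_pow, inv_mul_eq_div, le_div_iff₀ (by positivity), mul_comm]
  exact hle

/-- Word maps contract compact subsets of `Ω` exponentially in the length of the word. -/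
theorem exists_contraction {A : Set ℂ} (hA : IsCompact A) (hAΩ : A ⊆ S.Ω) :
    ∃ k C : ℝ, 0 < k ∧ k < 1 ∧ 0 ≤ C ∧ ∀ w : List (Fin S.m),
      (∀ x ∈ A, ‖deriv (S.word w) x‖ ≤ C * k ^ w.length) ∧
      ∀ x ∈ A, ∀ y ∈ A, dist (S.word w x) (S.word w y) ≤ C * k ^ w.length := by
  obtain ⟨k, M, hk0, hk1, hM0, hder⟩ := S.exists_norm_deriv_word_le
  have hloc : ∀ z ∈ S.Ω, ∃ r > 0, ball z r ⊆ S.Ω ∧ ∃ C, 0 ≤ C ∧ ∀ y ∈ ball z r,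
      ∀ w : List (Fin S.m), dist (S.word w z) (S.word w y) ≤ C * k ^ w.length := by
    intro z hz
    obtain ⟨r, hr, hsub⟩ := Metric.isOpen_iff.1 S.hopen z hz
    have hsub' : ball z (r / 2) ⊆ S.Ω := (ball_subset_ball (by linarith)).trans hsub
    refine ⟨r / 2, by positivity, hsub', M, hM0, fun y hy w => ?_⟩
    have h := (convex_ball z (r / 2)).norm_image_sub_le_of_norm_deriv_le
      (f := S.word w) (C := k ^ w.length * (M / (r / 2)))
      (fun x hx => S.differentiableAt_word w (hsub' hx))
      (fun x hx => hder w x (r / 2) (by positivity)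
        ((ball_subset_ball' (by rw [mem_ball] at hx; linarith)).trans hsub))
      hy (mem_ball_self (by positivity))
    rw [dist_eq_norm]
    refine h.trans ?_
    rw [mem_ball, dist_comm, dist_eq_norm] at hy
    calc k ^ w.length * (M / (r / 2)) * ‖z - y‖ ≤ k ^ w.length * (M / (r / 2)) * (r / 2) := by
          gcongr
      _ = M * k ^ w.length := by field_simp
  have hpair : ∀ x ∈ S.Ω, ∀ y ∈ S.Ω, ∃ C, 0 ≤ C ∧
      ∀ w : List (Fin S.m), dist (S.word w x) (S.word w y) ≤ C * k ^ w.length := by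
    intro x hx y hy
    refine S.hconn.isPreconnected.induction₂ (fun x y => ∃ C, 0 ≤ C ∧
      ∀ w : List (Fin S.m), dist (S.word w x) (S.word w y) ≤ C * k ^ w.length) ?_ ?_ ?_ hx hy
    · intro z hz
      obtain ⟨r, hr, -, C, hC, h⟩ := hloc z hz
      filter_upwards [nhdsWithin_le_nhds (ball_mem_nhds z hr)] with y hy
      exact ⟨C, hC, h y hy⟩
    · rintro x y z - - - ⟨C, hC, h⟩ ⟨C', hC', h'⟩
      refine ⟨C + C', add_nonneg hC hC', fun w => (dist_triangle _ (S.word w y) _).trans ?_⟩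
      rw [add_mul]
      exact add_le_add (h w) (h' w)
    · rintro x y - - ⟨C, hC, h⟩
      exact ⟨C, hC, fun w => by rw [dist_comm]; exact h w⟩
  obtain ⟨x₀, hx₀⟩ := S.hconn.nonempty
  obtain ⟨C, hC, hunif⟩ : ∃ C, 0 ≤ C ∧ ∀ y ∈ A, ∀ w : List (Fin S.m),
      dist (S.word w x₀) (S.word w y) ≤ C * k ^ w.length := by
    refine hA.induction_on (p := fun T => ∃ C, 0 ≤ C ∧ ∀ y ∈ T, ∀ w : List (Fin S.m),
      dist (S.word w x₀) (S.word w y) ≤ C * k ^ w.length) ⟨0, le_rfl, by simp⟩ ?_ ?_ ?_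
    · rintro s t hst ⟨C, hC, h⟩
      exact ⟨C, hC, fun y hy => h y (hst hy)⟩
    · rintro s t ⟨C, hC, h⟩ ⟨C', hC', h'⟩
      refine ⟨max C C', le_max_of_le_left hC, ?_⟩
      rintro y (hy | hy) w
      · exact (h y hy w).trans (by gcongr; exact le_max_left _ _)
      · exact (h' y hy w).trans (by gcongr; exact le_max_right _ _)
    · intro z hz
      obtain ⟨r, hr, -, C, hC, h⟩ := hloc z (hAΩ hz)
      obtain ⟨C', hC', h'⟩ := hpair x₀ hx₀ z (hAΩ hz)
      refine ⟨ball z r, nhdsWithin_le_nhds (ball_mem_nhds z hr), C' + C, add_nonneg hC' hC,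
        fun y hy w => (dist_triangle _ (S.word w z) _).trans ?_⟩
      rw [add_mul]
      exact add_le_add (h' w) (h y hy w)
  obtain ⟨δ, hδ, hthick⟩ := hA.exists_thickening_subset_open S.hopen hAΩ
  refine ⟨k, max (M / δ) (C + C), hk0, hk1, le_max_of_le_left (by positivity), fun w => ⟨?_, ?_⟩⟩
  · intro x hx
    refine (hder w x δ hδ ((ball_subset_thickening hx δ).trans hthick)).trans ?_
    rw [mul_comm]
    gcongr
    exact le_max_left _ _
  · intro x hx y hy
    calc dist (S.word w x) (S.word w y) ≤ C * k ^ w.length + C * k ^ w.length :=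
          (dist_triangle_left _ _ (S.word w x₀)).trans (add_le_add (hunif x hx w) (hunif y hy w))
      _ = (C + C) * k ^ w.length := by ring
      _ ≤ _ := by gcongr; exact le_max_right _ _

variable {S} {A : Set ℂ}

theorem IsAttractor.mapsTo_word (hA : S.IsAttractor A) (w : List (Fin S.m)) :
    MapsTo (S.word w) A A := by
  induction w with
  | nil => exact mapsTo_id _
  | cons i w ih =>
    intro x hx
    rw [hA.2.2.2]
    exact mem_iUnion.2 ⟨i, mem_image_of_mem _ (ih hx)⟩

theorem IsAttractor.isClosed_image_word (hA : S.IsAttractor A) (w : List (Fin S.m)) :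
    IsClosed (S.word w '' A) :=
  (hA.2.1.image_of_continuousOn
    ((S.differentiableOn_word w).continuousOn.mono hA.2.2.1)).isClosed

theorem IsAttractor.exists_mem_image_word (hA : S.IsAttractor A) (n : ℕ) :
    ∀ x ∈ A, ∃ w : List (Fin S.m), w.length = n ∧ x ∈ S.word w '' A := by
  induction n with
  | zero => exact fun x hx => ⟨[], rfl, x, hx, rfl⟩
  | succ n ih =>
    intro x hx
    rw [hA.2.2.2] at hx
    obtain ⟨i, y, hy, rfl⟩ := mem_iUnion.1 hx
    obtain ⟨w, hw, z, hz, rfl⟩ := ih y hy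
    exact ⟨i :: w, by simp [hw], z, hz, rfl⟩

theorem SSC.disjoint_image_word (hSSC : S.SSC A) (hA : S.IsAttractor A)
    (u v : List (Fin S.m)) (hlen : u.length = v.length) (hne : u ≠ v) :
    Disjoint (S.word u '' A) (S.word v '' A) := by
  induction u generalizing v with
  | nil => exact absurd (List.length_eq_zero_iff.1 hlen.symm).symm hne
  | cons i u ih =>
    cases v with
    | nil => simp at hlen
    | cons j v =>
      rw [Set.disjoint_left]
      rintro _ ⟨a, ha, rfl⟩ ⟨b, hb, hab⟩
      rw [word_cons, word_cons] at hab
      by_cases hij : i = j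
      · subst hij
        have heq := S.hinj i (S.mapsTo_word v (hA.2.2.1 hb)) (S.mapsTo_word u (hA.2.2.1 ha)) hab
        exact Set.disjoint_left.1 (ih v (by simpa using hlen) (by simpa using hne))
          (mem_image_of_mem _ ha) ⟨b, hb, heq⟩
      · exact Set.disjoint_left.1 (hSSC i j hij) (mem_image_of_mem _ (hA.mapsTo_word u ha))
          ⟨_, hA.mapsTo_word v hb, hab⟩

/-- Under the SSC, the pieces `g_v(A)` with `v ≠ w` of the same length as `w` form a closed set
which is a complement of `g_w(A)` in `A`. -/
theorem SSC.exists_isClosed_compl (hSSC : S.SSC A) (hA : S.IsAttractor A)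
    (w : List (Fin S.m)) : ∃ B : Set ℂ, IsClosed B ∧ Disjoint (S.word w '' A) B ∧
      A ⊆ S.word w '' A ∪ B := by
  have hfin : {v : List (Fin S.m) | v.length = w.length ∧ v ≠ w}.Finite :=
    (List.finite_length_eq (Fin S.m) w.length).subset fun v hv => hv.1
  refine ⟨⋃ v ∈ {v : List (Fin S.m) | v.length = w.length ∧ v ≠ w}, S.word v '' A,
    hfin.isClosed_biUnion fun v _ => hA.isClosed_image_word v, ?_, fun x hx => ?_⟩
  · simp only [Set.disjoint_iUnion_right]
    exact fun v hv => hSSC.disjoint_image_word hA w v hv.1.symm hv.2.symm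
  · obtain ⟨v, hv, hxv⟩ := hA.exists_mem_image_word w.length x hx
    by_cases hvw : v = w
    · exact Or.inl (hvw ▸ hxv)
    · exact Or.inr (mem_biUnion (show v ∈ {v | _} from ⟨hv, hvw⟩) hxv)

theorem IsAttractor.exists_isFixedPt_word (hA : S.IsAttractor A) (w : List (Fin S.m))
    (hw : w ≠ []) : ∃ b ∈ A, S.word w b = b := by
  obtain ⟨k, C, hk0, hk1, hC, h⟩ := S.exists_contraction hA.2.1 hA.2.2.1
  obtain ⟨x, hx⟩ := hA.1
  have hiter : ∀ n : ℕ, ∃ v : List (Fin S.m), n ≤ v.length ∧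
      ∀ y, (S.word w)^[n] y = S.word v y := by
    intro n
    induction n with
    | zero => exact ⟨[], le_rfl, fun y => rfl⟩
    | succ n ih =>
      obtain ⟨v, hv, hvy⟩ := ih
      have := List.length_pos_iff.2 hw
      exact ⟨w ++ v, by rw [List.length_append]; omega, fun y => by
        rw [Function.iterate_succ_apply', hvy, word_append]⟩
  have hmem : ∀ n : ℕ, (S.word w)^[n] x ∈ A := fun n => (hA.mapsTo_word w).iterate n hx
  have hcauchy : CauchySeq fun n : ℕ => (S.word w)^[n] x := by
    refine cauchySeq_of_le_geometric k C hk1 fun n => ?_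
    obtain ⟨v, hv, hvy⟩ := hiter n
    rw [Function.iterate_succ_apply, hvy, hvy]
    refine ((h v).2 x hx _ (hA.mapsTo_word w hx)).trans ?_
    exact mul_le_mul_of_nonneg_left (pow_le_pow_of_le_one hk0.le hk1.le hv) hC
  obtain ⟨b, hb⟩ := cauchySeq_tendsto_of_complete hcauchy
  have hbA : b ∈ A := hA.2.1.isClosed.mem_of_tendsto hb (Eventually.of_forall hmem)
  refine ⟨b, hbA, ?_⟩
  have hcont : ContinuousAt (S.word w) b :=
    (S.differentiableAt_word w (hA.2.2.1 hbA)).continuousAt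
  refine tendsto_nhds_unique ?_ ((tendsto_add_atTop_iff_nat 1).2 hb)
  simpa only [Function.iterate_succ_apply'] using! hcont.tendsto.comp hb

/-- Under the SSC, the fixed points of word maps with contracting derivative are attracting fixed
points of local symmetries of the attractor. -/
theorem SSC.mem_attrFixedPts (hSSC : S.SSC A) (hA : S.IsAttractor A) {w : List (Fin S.m)} {b : ℂ}
    (hbA : b ∈ A) (hb : S.word w b = b) (hd : ‖deriv (S.word w) b‖ < 1) :
    b ∈ AttrFixedPts A := by
  obtain ⟨B, hB, hdisj, hcov⟩ := hSSC.exists_isClosed_compl hA w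
  have hbΩ := hA.2.2.1 hbA
  have hbB : b ∈ Bᶜ := Set.disjoint_left.1 hdisj ⟨b, hbA, hb⟩
  have hcont : ContinuousAt (S.word w) b := (S.differentiableAt_word w hbΩ).continuousAt
  have hnhds : S.Ω ∩ S.word w ⁻¹' Bᶜ ∈ 𝓝 b :=
    inter_mem (S.hopen.mem_nhds hbΩ)
      (hcont.preimage_mem_nhds (hB.isOpen_compl.mem_nhds (by rwa [hb])))
  obtain ⟨r, hr, hsub⟩ := Metric.mem_nhds_iff.1 hnhds
  refine ⟨ball b r, S.word w, isOpen_ball, isConnected_ball hr, ⟨b, mem_ball_self hr, hbA⟩,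
    ⟨(S.differentiableOn_word w).mono fun x hx => (hsub hx).1, fun x hx => ⟨fun hxA =>
      hA.mapsTo_word w hxA, fun hxA => ?_⟩⟩, mem_ball_self hr, hb,
    norm_pos_iff.2 (S.deriv_word_ne_zero w hbΩ), hd⟩
  obtain ⟨y, hy, hyx⟩ := (hcov hxA).resolve_right (hsub hx).2
  rwa [← S.injOn_word w (hA.2.2.1 hy) (hsub hx).1 hyx]

theorem SSC.isTotallyDisconnected (hSSC : S.SSC A) (hA : S.IsAttractor A) :
    IsTotallyDisconnected A := by
  obtain ⟨k, C, hk0, hk1, hC, h⟩ := S.exists_contraction hA.2.1 hA.2.2.1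
  intro T hTA hT x hx y hy
  have hle : ∀ n : ℕ, dist x y ≤ C * k ^ n := by
    intro n
    obtain ⟨w, rfl, hxw⟩ := hA.exists_mem_image_word n x (hTA hx)
    obtain ⟨B, hB, hdisj, hcov⟩ := hSSC.exists_isClosed_compl hA w
    have hsub : T ⊆ S.word w '' A := by
      refine (isPreconnected_iff_subset_of_disjoint_closed.1 hT _ B (hA.isClosed_image_word w) hB
        (hTA.trans hcov) (by rw [hdisj.inter_eq, inter_empty])).resolve_right fun hTB => ?_
      exact Set.disjoint_left.1 hdisj hxw (hTB hx)
    obtain ⟨a, ha, rfl⟩ := hxw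
    obtain ⟨b, hb, rfl⟩ := hsub hy
    exact (h w).2 a ha b hb
  have hlim : Tendsto (fun n : ℕ => C * k ^ n) atTop (𝓝 0) := by
    simpa using (tendsto_pow_atTop_nhds_zero_of_lt_one hk0.le hk1).const_mul C
  exact dist_le_zero.1 (ge_of_tendsto' hlim hle)

theorem IsAttractor.mem_closure_diff_singleton (hA : S.IsAttractor A) (hA2 : A.Nontrivial)
    {x : ℂ} (hx : x ∈ A) : x ∈ closure (A \ {x}) := by
  obtain ⟨k, C, hk0, hk1, hC, h⟩ := S.exists_contraction hA.2.1 hA.2.2.1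
  rw [Metric.mem_closure_iff]
  intro ε hε
  have hlim : Tendsto (fun n : ℕ => C * k ^ n) atTop (𝓝 0) := by
    simpa using (tendsto_pow_atTop_nhds_zero_of_lt_one hk0.le hk1).const_mul C
  obtain ⟨n, hn⟩ := (hlim.eventually_lt_const hε).exists
  obtain ⟨w, rfl, a, ha, rfl⟩ := hA.exists_mem_image_word n x hx
  obtain ⟨b, hb, hba⟩ := hA2.exists_ne a
  refine ⟨S.word w b, ⟨hA.mapsTo_word w hb, fun hw => hba ?_⟩, ((h w).2 a ha b hb).trans_lt hn⟩
  exact S.injOn_word w (hA.2.2.1 hb) (hA.2.2.1 ha) hw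

theorem SSC.jLike (hSSC : S.SSC A) (hA : S.IsAttractor A) : JLike A := by
  obtain ⟨k, C, hk0, hk1, hC, h⟩ := S.exists_contraction hA.2.1 hA.2.2.1
  refine ⟨univ, isOpen_univ, subset_univ A, fun x hx => Metric.mem_closure_iff.2 fun ε hε => ?_⟩
  have hlim : Tendsto (fun n : ℕ => C * k ^ n) atTop (𝓝 0) := by
    simpa using (tendsto_pow_atTop_nhds_zero_of_lt_one hk0.le hk1).const_mul C
  obtain ⟨n, ⟨hnε, hn1⟩, hn0⟩ := (((hlim.eventually_lt_const hε).and
    (hlim.eventually_lt_const one_pos)).and (eventually_ge_atTop 1)).exists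
  obtain ⟨w, rfl, a, ha, rfl⟩ := hA.exists_mem_image_word n x hx.2
  obtain ⟨b, hbA, hb⟩ := hA.exists_isFixedPt_word w (List.length_pos_iff.1 hn0)
  refine ⟨b, hSSC.mem_attrFixedPts hA hbA hb (((h w).1 b hbA).trans_lt hn1), ?_⟩
  have hab := (h w).2 a ha b hbA
  rw [hb] at hab
  exact hab.trans_lt hnε

end HolIFS

/-- Lemma: the attractor of a holomorphic IFS with the SSC is a J-like Cantor set
(it is compact by definition; moreover it is totally disconnected, has no isolated
points, and is J-like). -/
theorem stmt_6 (S : HolIFS) (A : Set ℂ) (hA : S.IsAttractor A) (hA2 : A.Nontrivial)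
    (hSSC : S.SSC A) :
    IsTotallyDisconnected A ∧ (∀ x ∈ A, x ∈ closure (A \ {x})) ∧ JLike A :=
  ⟨hSSC.isTotallyDisconnected hA, fun _ hx => hA.mem_closure_diff_singleton hA2 hx,
    hSSC.jLike hA⟩
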